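/- In every equilibrium (x,p) of the price competition game constructed from an Exact-3-Cover instance, every set vendor ν_S (for S = {e_1,e_2,e_3} ∈ 𝒞) has utility exactly 90 and its price satisfies p_{ν_S} ∈ {6, 30}; if p_{ν_S} = 30 then ν_S is assigned exactly the buyers of type b_{S,h}, and if p_{ν_S} = 6 then ν_S is assigned the buyers of types b_{S,h}, b_{S,ℓ}, b_{e_1}, b_{e_2} and b_{e_3}. -/

import Mathlib

open Finset

/-- A price competition game with buyer types `N` and vendors `M`
(including the special "abstain" vendor). -/
structure PCGame (N M : Type) [Fintype N] [Fintype M] where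
  abstain : M
  μ : N → ℝ
  v : N → M → ℝ
  c : M → ℝ
  μ_pos : ∀ i, 0 < μ i
  v_nonneg : ∀ i j, 0 ≤ v i j
  c_nonneg : ∀ j, 0 ≤ c j
  v_abstain : ∀ i, v i abstain = 0
  c_abstain : c abstain = 0

namespace PCGame

variable {N M : Type} [Fintype N] [Fintype M]

/-- `p` is a valid price vector: every price is at least the production cost and
the abstain vendor has price `0`. -/
def IsPrice (G : PCGame N M) (p : M → ℝ) : Prop :=
  (∀ j, G.c j ≤ p j) ∧ p G.abstain = 0

/-- `x` is a valid buyers-to-vendors assignment. -/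
def IsAssignment (G : PCGame N M) (x : N → M → ℝ) : Prop :=
  (∀ i j, 0 ≤ x i j) ∧ ∀ i, ∑ j, x i j = G.μ i

/-- `x` is consistent to `p`: positive volume goes only to utility-maximizing vendors. -/
def Consistent (G : PCGame N M) (x : N → M → ℝ) (p : M → ℝ) : Prop :=
  ∀ i j, 0 < x i j → ∀ j', G.v i j' - p j' ≤ G.v i j - p j

/-- Utility of vendor `j` under assignment `x` and prices `p`. -/
noncomputable def util (G : PCGame N M) (x : N → M → ℝ) (p : M → ℝ) (j : M) : ℝ :=
  (p j - G.c j) * ∑ i, x i j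

/-- Total utility of the buyers of type `i`. -/
noncomputable def buyerUtil (G : PCGame N M) (x : N → M → ℝ) (p : M → ℝ) (i : N) : ℝ :=
  ∑ j, x i j * (G.v i j - p j)

/-- `(x, p)` is a (pure Nash) equilibrium: `x` is consistent to `p` and no (non-abstain)
vendor can increase its utility by deviating to another price. -/
def IsEquilibrium [DecidableEq M] (G : PCGame N M) (x : N → M → ℝ) (p : M → ℝ) : Prop :=
  G.IsPrice p ∧ G.IsAssignment x ∧ G.Consistent x p ∧
    ∀ j, j ≠ G.abstain → ∀ p' : ℝ, G.c j ≤ p' →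
      ∀ y, G.IsAssignment y → G.Consistent y (Function.update p j p') →
        G.util y (Function.update p j p') j ≤ G.util x p j

/-- Social welfare of assignment `x`. -/
noncomputable def SW (G : PCGame N M) (x : N → M → ℝ) : ℝ :=
  ∑ i, ∑ j, x i j * (G.v i j - G.c j)

/-- Optimal social welfare. -/
noncomputable def SWopt (G : PCGame N M) : ℝ :=
  ∑ i, G.μ i * Finset.univ.sup' ⟨G.abstain, Finset.mem_univ _⟩ (fun j => G.v i j - G.c j)

/-- `θ_j(p)`: the supremum utility of vendor `j` over all of its price deviations
(the abstain vendor cannot deviate from price `0`). -/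
noncomputable def theta [DecidableEq M] (G : PCGame N M) (p : M → ℝ) (j : M) : ℝ :=
  sSup {u : ℝ | ∃ (p' : ℝ) (y : N → M → ℝ), G.c j ≤ p' ∧ (j = G.abstain → p' = 0) ∧
    G.IsAssignment y ∧ G.Consistent y (Function.update p j p') ∧
    u = G.util y (Function.update p j p') j}

/-- The minimum subsidy that makes vendor `j` not want to deviate from `(x, p)`. -/
noncomputable def subsidy [DecidableEq M] (G : PCGame N M) (x : N → M → ℝ) (p : M → ℝ)
    (j : M) : ℝ :=
  G.theta p j - G.util x p j

end PCGame

namespace PCGame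

variable {N M : Type} [Fintype N] [Fintype M]

theorem IsAssignment.le_volume {G : PCGame N M} {x : N → M → ℝ} (hx : G.IsAssignment x)
    (i : N) (j : M) : x i j ≤ G.μ i :=
  hx.2 i ▸ Finset.single_le_sum (fun j _ => hx.1 i j) (Finset.mem_univ j)

/-- A buyer never buys from a vendor whose price exceeds the buyer's valuation. -/
theorem Consistent.eq_zero_of_lt {G : PCGame N M} {x : N → M → ℝ} {p : M → ℝ}
    (hc : G.Consistent x p) (hx : G.IsAssignment x) (hp : G.IsPrice p) {i : N} {j : M}
    (h : G.v i j < p j) : x i j = 0 := by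
  by_contra hne
  have := hc i j (lt_of_le_of_ne (hx.1 i j) (Ne.symm hne)) G.abstain
  rw [G.v_abstain, hp.2] at this
  linarith

theorem exists_consistent (G : PCGame N M) (p : M → ℝ) :
    ∃ y, G.IsAssignment y ∧ G.Consistent y p := by
  classical
  have : Nonempty M := ⟨G.abstain⟩
  choose f hf using fun i => Finite.exists_max (fun j => G.v i j - p j)
  refine ⟨fun i j => if j = f i then G.μ i else 0, ⟨fun i j => ?_, fun i => by simp⟩,
    fun i j h j' => ?_⟩
  · dsimp only
    split_ifs
    exacts [(G.μ_pos i).le, le_rfl]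
  · by_cases hj : j = f i
    · exact hj ▸ hf i j'
    · simp [hj] at h

/-- Under a consistent assignment, a buyer type with a unique best vendor buys only there. -/
theorem Consistent.eq_volume {G : PCGame N M} {x : N → M → ℝ} {p : M → ℝ}
    (hc : G.Consistent x p) (hx : G.IsAssignment x) {i : N} {j : M}
    (h : ∀ j', j' ≠ j → G.v i j' - p j' < G.v i j - p j) : x i j = G.μ i := by
  rw [← hx.2 i, Finset.sum_eq_single j _ (by simp)]
  intro j' _ hj'
  by_contra hne
  exact absurd (hc i j' (lt_of_le_of_ne (hx.1 i j') (Ne.symm hne)) j) (not_le.2 (h j' hj'))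

/-- In equilibrium, a vendor earns at least what it could extract from a buyer type that values
no other vendor. -/
theorem IsEquilibrium.volume_mul_le_util [DecidableEq M] {G : PCGame N M} {x : N → M → ℝ}
    {p : M → ℝ} (h : G.IsEquilibrium x p) {i : N} {j : M} (hcost : G.c j < G.v i j)
    (hv : ∀ j', j' ≠ j → G.v i j' = 0) :
    (G.v i j - G.c j) * G.μ i ≤ G.util x p j := by
  obtain ⟨hp, hx, hc, hdev⟩ := h
  have hj : j ≠ G.abstain := by
    rintro rfl
    rw [G.c_abstain, G.v_abstain] at hcost
    exact lt_irrefl _ hcost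
  have hμ := G.μ_pos i
  by_contra! hlt
  have hmid : G.util x p j / G.μ i < G.v i j - G.c j := by rwa [div_lt_iff₀ hμ]
  obtain ⟨r, hr₁, hr₂⟩ := exists_between
    (max_lt hmid (sub_pos.2 hcost) : max (G.util x p j / G.μ i) 0 < _)
  have hr : 0 < r := (le_max_right _ _).trans_lt hr₁
  have hur : G.util x p j < r * G.μ i :=
    (div_lt_iff₀ hμ).1 ((le_max_left _ _).trans_lt hr₁)
  obtain ⟨y, hy, hyc⟩ := G.exists_consistent (Function.update p j (G.c j + r))
  have hyi : y i j = G.μ i := by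
    refine hyc.eq_volume hy fun j' hj' => ?_
    have h₁ := hp.1 j'
    have h₂ := G.c_nonneg j'
    rw [Function.update_self, Function.update_of_ne hj', hv j' hj']
    linarith
  have hle := hdev j hj (G.c j + r) (by linarith) y hy hyc
  have hsum : y i j ≤ ∑ i', y i' j :=
    Finset.single_le_sum (fun i' _ => hy.1 i' j) (Finset.mem_univ i)
  rw [util, Function.update_self, add_sub_cancel_left] at hle
  have := mul_le_mul_of_nonneg_left hsum hr.le
  rw [hyi] at this
  linarith

end PCGame

/-- in every equilibrium of the X3C game, every set vendor `ν_S` has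
utility exactly `90`, its price is `6` or `30`, and its assigned buyers are as
described.  (Same encoding of buyers and vendors as in Statement 10.) -/
theorem stmt11 {U : Type} [Fintype U] [DecidableEq U] (q : ℕ)
    (hU : Fintype.card U = 3 * q)
    (C : Finset (Finset U)) (hC : ∀ S ∈ C, S.card = 3)
    (G : PCGame (U ⊕ U ⊕ ↥C ⊕ ↥C) (Option (↥C ⊕ U ⊕ U)))
    (hab : G.abstain = none)
    (hμe : ∀ e : U, G.μ (Sum.inl e) = 1)
    (hμs : ∀ e : U, G.μ (Sum.inr (Sum.inl e)) = 1)
    (hμh : ∀ S : ↥C, G.μ (Sum.inr (Sum.inr (Sum.inl S))) = 3)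
    (hμl : ∀ S : ↥C, G.μ (Sum.inr (Sum.inr (Sum.inr S))) = 9)
    (hcost : ∀ j, G.c j = 0)
    (hv1 : ∀ (e : U) (S : ↥C), G.v (Sum.inl e) (some (Sum.inl S)) =
      if e ∈ S.1 then 12 else 0)
    (hv2 : ∀ e e' : U, G.v (Sum.inl e) (some (Sum.inr (Sum.inl e'))) =
      if e = e' then 5 else 0)
    (hv3 : ∀ e e' : U, G.v (Sum.inl e) (some (Sum.inr (Sum.inr e'))) =
      if e = e' then 3 else 0)
    (hv4 : ∀ (e : U) (S : ↥C), G.v (Sum.inr (Sum.inl e)) (some (Sum.inl S)) = 0)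
    (hv5 : ∀ e e' : U, G.v (Sum.inr (Sum.inl e)) (some (Sum.inr (Sum.inl e'))) =
      if e = e' then 3 else 0)
    (hv6 : ∀ e e' : U, G.v (Sum.inr (Sum.inl e)) (some (Sum.inr (Sum.inr e'))) =
      if e = e' then 5 else 0)
    (hv7 : ∀ S S' : ↥C, G.v (Sum.inr (Sum.inr (Sum.inl S))) (some (Sum.inl S')) =
      if S = S' then 30 else 0)
    (hv8 : ∀ (S : ↥C) (e : U),
      G.v (Sum.inr (Sum.inr (Sum.inl S))) (some (Sum.inr (Sum.inl e))) = 0)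
    (hv9 : ∀ (S : ↥C) (e : U),
      G.v (Sum.inr (Sum.inr (Sum.inl S))) (some (Sum.inr (Sum.inr e))) = 0)
    (hv10 : ∀ S S' : ↥C, G.v (Sum.inr (Sum.inr (Sum.inr S))) (some (Sum.inl S')) =
      if S = S' then 6 else 0)
    (hv11 : ∀ (S : ↥C) (e : U),
      G.v (Sum.inr (Sum.inr (Sum.inr S))) (some (Sum.inr (Sum.inl e))) = 0)
    (hv12 : ∀ (S : ↥C) (e : U),
      G.v (Sum.inr (Sum.inr (Sum.inr S))) (some (Sum.inr (Sum.inr e))) = 0)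
    (x : (U ⊕ U ⊕ ↥C ⊕ ↥C) → Option (↥C ⊕ U ⊕ U) → ℝ)
    (p : Option (↥C ⊕ U ⊕ U) → ℝ)
    (heq : G.IsEquilibrium x p) :
    ∀ S : ↥C,
      G.util x p (some (Sum.inl S)) = 90 ∧
      (p (some (Sum.inl S)) = 6 ∨ p (some (Sum.inl S)) = 30) ∧
      (p (some (Sum.inl S)) = 30 →
        x (Sum.inr (Sum.inr (Sum.inl S))) (some (Sum.inl S)) = 3 ∧
        ∀ i, i ≠ Sum.inr (Sum.inr (Sum.inl S)) → x i (some (Sum.inl S)) = 0) ∧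
      (p (some (Sum.inl S)) = 6 →
        x (Sum.inr (Sum.inr (Sum.inl S))) (some (Sum.inl S)) = 3 ∧
        x (Sum.inr (Sum.inr (Sum.inr S))) (some (Sum.inl S)) = 9 ∧
        (∀ e : U, e ∈ S.1 → x (Sum.inl e) (some (Sum.inl S)) = 1) ∧
        ∀ i, x i (some (Sum.inl S)) ≠ 0 →
          i = Sum.inr (Sum.inr (Sum.inl S)) ∨ i = Sum.inr (Sum.inr (Sum.inr S)) ∨
          ∃ e ∈ S.1, i = Sum.inl e) := by
  intro S
  have hU90 : 90 ≤ G.util x p (some (Sum.inl S)) := by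
    have h := heq.volume_mul_le_util (i := Sum.inr (Sum.inr (Sum.inl S)))
      (j := some (Sum.inl S)) (by rw [hcost, hv7]; norm_num) (by
        rintro (_ | S' | e | e) hne
        · rw [← hab, G.v_abstain]
        · rw [hv7, if_neg (by rintro rfl; exact hne rfl)]
        · exact hv8 S e
        · exact hv9 S e)
    rw [hcost, hv7, hμh, if_pos rfl] at h
    linarith
  obtain ⟨hp, hx, hc, -⟩ := heq
  have hu : G.util x p (some (Sum.inl S)) =
      p (some (Sum.inl S)) * ∑ i, x i (some (Sum.inl S)) := by
    rw [PCGame.util, hcost, sub_zero]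
  have hP : 0 < p (some (Sum.inl S)) := by
    refine lt_of_le_of_ne (hcost (some (Sum.inl S)) ▸ hp.1 _) fun h0 => ?_
    rw [hu, ← h0] at hU90
    linarith
  have hz {i} : G.v i (some (Sum.inl S)) < p (some (Sum.inl S)) → x i (some (Sum.inl S)) = 0 :=
    hc.eq_zero_of_lt hx hp
  have hz1 (e : U) (he : e ∉ S.1) : x (Sum.inl e) (some (Sum.inl S)) = 0 :=
    hz (by rwa [hv1, if_neg he])
  have hz2 (e : U) : x (Sum.inr (Sum.inl e)) (some (Sum.inl S)) = 0 := hz (by rwa [hv4])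
  have hz3 (S' : ↥C) (h : S' ≠ S) : x (Sum.inr (Sum.inr (Sum.inl S'))) (some (Sum.inl S)) = 0 :=
    hz (by rwa [hv7, if_neg h])
  have hz4 (S' : ↥C) (h : S' ≠ S) : x (Sum.inr (Sum.inr (Sum.inr S'))) (some (Sum.inl S)) = 0 :=
    hz (by rwa [hv10, if_neg h])
  have hsum : ∑ i, x i (some (Sum.inl S)) = ∑ e ∈ S.1, x (Sum.inl e) (some (Sum.inl S)) +
      (x (Sum.inr (Sum.inr (Sum.inl S))) (some (Sum.inl S)) +
        x (Sum.inr (Sum.inr (Sum.inr S))) (some (Sum.inl S))) := by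
    rw [Fintype.sum_sum_type, Fintype.sum_sum_type, Fintype.sum_sum_type,
      Finset.sum_eq_zero (fun e _ => hz2 e), zero_add,
      Finset.sum_eq_single S (fun S' _ h => hz3 S' h) (by simp),
      Finset.sum_eq_single S (fun S' _ h => hz4 S' h) (by simp),
      Finset.sum_subset (Finset.subset_univ S.1) (fun e _ he => hz1 e he)]
  rw [hsum] at hu
  have hle (e : U) : x (Sum.inl e) (some (Sum.inl S)) ≤ 1 := hμe e ▸ hx.le_volume _ _
  have hE : ∑ e ∈ S.1, x (Sum.inl e) (some (Sum.inl S)) ≤ 3 := by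
    have h := Finset.sum_le_card_nsmul S.1 _ 1 (fun e _ => hle e)
    rw [hC S.1 S.2] at h
    simpa using h
  have hH : x (Sum.inr (Sum.inr (Sum.inl S))) (some (Sum.inl S)) ≤ 3 :=
    hμh S ▸ hx.le_volume _ _
  have hL : x (Sum.inr (Sum.inr (Sum.inr S))) (some (Sum.inl S)) ≤ 9 :=
    hμl S ▸ hx.le_volume _ _
  have hE0 : 12 < p (some (Sum.inl S)) → ∀ e, x (Sum.inl e) (some (Sum.inl S)) = 0 := by
    intro h e
    refine hz ?_
    rw [hv1]
    split_ifs <;> linarith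
  have hL0 : 6 < p (some (Sum.inl S)) →
      x (Sum.inr (Sum.inr (Sum.inr S))) (some (Sum.inl S)) = 0 :=
    fun h => hz (by rwa [hv10, if_pos rfl])
  have hH0 : 30 < p (some (Sum.inl S)) →
      x (Sum.inr (Sum.inr (Sum.inl S))) (some (Sum.inl S)) = 0 :=
    fun h => hz (by rwa [hv7, if_pos rfl])
  have hsupp (i) (hi : x i (some (Sum.inl S)) ≠ 0) :
      i = Sum.inr (Sum.inr (Sum.inl S)) ∨ i = Sum.inr (Sum.inr (Sum.inr S)) ∨
        ∃ e ∈ S.1, i = Sum.inl e := by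
    rcases i with e | e | S' | S'
    · exact Or.inr (Or.inr ⟨e, not_not.1 fun he => hi (hz1 e he), rfl⟩)
    · exact absurd (hz2 e) hi
    · exact Or.inl (by rw [not_not.1 fun h => hi (hz3 S' h)])
    · exact Or.inr (Or.inl (by rw [not_not.1 fun h => hi (hz4 S' h)]))
  set P := p (some (Sum.inl S))
  set E := ∑ e ∈ S.1, x (Sum.inl e) (some (Sum.inl S)) with hEdef
  set H := x (Sum.inr (Sum.inr (Sum.inl S))) (some (Sum.inl S))
  set L := x (Sum.inr (Sum.inr (Sum.inr S))) (some (Sum.inl S))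
  have hEzero : 12 < P → E = 0 := fun h => Finset.sum_eq_zero fun e _ => hE0 h e
  rw [hu] at hU90
  have hcases : P = 6 ∨ P = 30 := by
    rcases lt_trichotomy P 6 with h6 | h6 | h6
    · nlinarith
    · exact Or.inl h6
    rw [hL0 h6] at hU90
    rcases le_or_gt P 12 with h12 | h12
    · nlinarith
    rw [hEzero h12] at hU90
    rcases lt_trichotomy P 30 with h30 | h30 | h30
    · nlinarith
    · exact Or.inr h30
    · rw [hH0 h30] at hU90
      linarith
  have h30 : P = 30 → H = 3 ∧ L = 0 ∧ E = 0 := by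
    intro h
    have hE' := hEzero (by linarith)
    have hL' := hL0 (by linarith)
    rw [hE', hL', h] at hU90
    exact ⟨by linarith, hL', hE'⟩
  have h6 : P = 6 → H = 3 ∧ L = 9 ∧ E = 3 := by
    intro h
    rw [h] at hU90
    refine ⟨?_, ?_, ?_⟩ <;> linarith
  refine ⟨?_, hcases, fun h => ⟨(h30 h).1, fun i hi => ?_⟩,
    fun h => ⟨(h6 h).1, (h6 h).2.1, ?_, hsupp⟩⟩
  · rw [hu]
    rcases hcases with h | h
    · obtain ⟨hH', hL', hE'⟩ := h6 h
      rw [hH', hL', hE', h]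
      norm_num
    · obtain ⟨hH', hL', hE'⟩ := h30 h
      rw [hH', hL', hE', h]
      norm_num
  · by_contra hne
    rcases hsupp i hne with rfl | rfl | ⟨e, -, rfl⟩
    · exact hi rfl
    · exact hne (h30 h).2.1
    · exact hne (hE0 (by linarith) e)
  · refine (Finset.sum_eq_sum_iff_of_le (fun e _ => hle e)).1 ?_
    rw [← hEdef, (h6 h).2.2, Finset.sum_const, hC S.1 S.2]
    norm_num
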